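/- Let a > 1, L(z,w) := (a·w, z), and R > 0. Then the union over n ≥ 0 of the preimages L^{−n}(W_R) equals the product of right half planes {(z,w) ∈ ℂ × ℂ : Re z > 0 and Re w > 0}. -/

import Mathlib

/-- `W_R = {(z,w) : Re z > R, Re w > R}`. -/
def W (R : ℝ) : Set (ℂ × ℂ) := {p : ℂ × ℂ | R < p.1.re ∧ R < p.2.re}

/-- The linear map `L(z,w) = (a·w, z)`. -/
noncomputable def L (a : ℝ) : ℂ × ℂ → ℂ × ℂ := fun p => ((a : ℂ) * p.2, p.1)

theorem iterate_L_two_mul (a : ℝ) (n : ℕ) (p : ℂ × ℂ) :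
    (L a)^[2 * n] p = ((a : ℂ) ^ n * p.1, (a : ℂ) ^ n * p.2) := by
  rw [Function.iterate_mul]
  induction n with
  | zero => simp
  | succ n ih =>
    rw [Function.iterate_succ_apply', ih]
    simp [L, pow_succ', mul_assoc]

theorem re_pos_of_iterate_L {a : ℝ} (ha : 0 < a) (n : ℕ) (p : ℂ × ℂ)
    (h : 0 < ((L a)^[n] p).1.re ∧ 0 < ((L a)^[n] p).2.re) : 0 < p.1.re ∧ 0 < p.2.re := by
  induction n generalizing p with
  | zero => exact h
  | succ n ih =>
    rw [Function.iterate_succ_apply] at h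
    obtain ⟨h₁, h₂⟩ := ih _ h
    simp only [L, Complex.re_ofReal_mul] at h₁ h₂
    exact ⟨h₂, pos_of_mul_pos_right h₁ ha.le⟩

/-- The union over `n ≥ 0` of the preimages `L^{-n}(W_R) = (Lⁿ)⁻¹(W_R)` is the product
of right half planes `{(z,w) : Re z > 0, Re w > 0}`. -/
theorem stmt14 (a : ℝ) (ha : 1 < a) (R : ℝ) (hR : 0 < R) :
    (⋃ n : ℕ, (L a)^[n] ⁻¹' W R) = {p : ℂ × ℂ | 0 < p.1.re ∧ 0 < p.2.re} := by
  ext p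
  simp only [Set.mem_iUnion, Set.mem_preimage, Set.mem_ofPred_eq, W]
  constructor
  · rintro ⟨n, h₁, h₂⟩
    exact re_pos_of_iterate_L (by linarith) n p ⟨hR.trans h₁, hR.trans h₂⟩
  · rintro ⟨h₁, h₂⟩
    have ht := tendsto_pow_atTop_atTop_of_one_lt ha
    obtain ⟨n, hn₁, hn₂⟩ :=
      (((ht.atTop_mul_const h₁).eventually_gt_atTop R).and
        ((ht.atTop_mul_const h₂).eventually_gt_atTop R)).exists
    refine ⟨2 * n, ?_⟩
    rw [iterate_L_two_mul, ← Complex.ofReal_pow]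
    simpa only [Complex.re_ofReal_mul] using And.intro hn₁ hn₂
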